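/- arXiv:math/0404222 — 2 statements merged into one kernel-verified Lean document; each statement's English description precedes it below -/
import Mathlib

section
/- Let λ be a regular cardinal with λ^{ℵ₀} = λ. Then there is a first-order model M of cardinality λ (in a vocabulary of cardinality at most λ) such that: (a) M has no non-trivial automorphism; and (b) for every ordinal α < λ there are elements c₁ ≠ c₂ of M such that the expansions (M, c₁) and (M, c₂) are EF_{α,λ}-equivalent (in particular EF_α-equivalent); by (a), for such c₁ ≠ c₂ the models (M, c₁) and (M, c₂) are non-isomorphic. -/
open FirstOrder

universe u

namespace EFGame

variable (L : FirstOrder.Language.{0, 0})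

/-- A set of pairs `f ⊆ M × N` is a partial isomorphism from `M` into `N` when it is the
graph of an injective partial function which preserves all atomic formulas (and hence
their negations). -/
def IsPartialIso (M N : Type) [L.Structure M] [L.Structure N] (f : Set (M × N)) : Prop :=
  (∀ p ∈ f, ∀ q ∈ f, p.1 = q.1 ↔ p.2 = q.2) ∧
  (∀ (n : ℕ) (φ : L.BoundedFormula Empty n), φ.IsAtomic →
    ∀ xs : Fin n → M × N, (∀ i, xs i ∈ f) →
      (φ.Realize (fun e => e.elim) (fun i => (xs i).1) ↔
        φ.Realize (fun e => e.elim) (fun i => (xs i).2)))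

/-- The isomorphism player ISO has a winning strategy in the Ehrenfeucht–Fraïssé game
`⅁^α_μ(f₀, M, N)` of length `α` where the anti-isomorphism player AIS plays pairs of sets of
total size `< 1 + μ`.  A strategy is encoded by the ISO responses `σ β A` (the partial
isomorphism `f_{β+1}`) to a history `A` of AIS moves; it may only depend on the part of the
history already played, and all its responses must be legal moves: partial isomorphisms,
increasing with `β`, extending `f₀`, and covering the sets played by AIS.  (At a limit stage
`β` the current position is `f_β = ⋃_{γ<β} σ γ A`, which is automatically a partial
isomorphism, so ISO wins a play iff all the responses along it are legal.) -/
def WinIso (M N : Type) [L.Structure M] [L.Structure N] (f₀ : Set (M × N))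
    (α : Ordinal.{0}) (μ : Cardinal.{0}) : Prop :=
  ∃ σ : Ordinal.{0} → (Ordinal.{0} → Set M × Set N) → Set (M × N),
    (∀ β A A', (∀ γ ≤ β, A γ = A' γ) → σ β A = σ β A') ∧
    (∀ A : Ordinal.{0} → Set M × Set N,
      (∀ β, β < α → Cardinal.mk ↥(A β).1 + Cardinal.mk ↥(A β).2 < 1 + μ) →
      ∀ β, β < α →
        IsPartialIso L M N (σ β A) ∧
        f₀ ⊆ σ β A ∧
        (∀ γ, γ < β → σ γ A ⊆ σ β A) ∧
        (A β).1 ⊆ Prod.fst '' σ β A ∧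
        (A β).2 ⊆ Prod.snd '' σ β A)

/-- `M` and `N` are `EF_{α,μ}`-equivalent: ISO has a winning strategy in the game
`⅁^α_μ(M, N)` (starting from the empty partial isomorphism). -/
def EFEquiv (M N : Type) [L.Structure M] [L.Structure N]
    (α : Ordinal.{0}) (μ : Cardinal.{0}) : Prop :=
  WinIso L M N ∅ α μ

/-- The expansions `(M, c₁)` and `(N, c₂)` of `M` and `N` by one new constant are
`EF_{α,μ}`-equivalent.  The expansions are formed in the language `L[[Unit]]` obtained
from `L` by adding one constant symbol, interpreted as `c₁` in `M` and as `c₂` in `N`. -/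
def EFEquivC (M N : Type) [L.Structure M] [L.Structure N] (c₁ : M) (c₂ : N)
    (α : Ordinal.{0}) (μ : Cardinal.{0}) : Prop :=
  letI : (Language.constantsOn Unit).Structure M :=
    Language.constantsOn.structure (fun _ => c₁)
  letI : (Language.constantsOn Unit).Structure N :=
    Language.constantsOn.structure (fun _ => c₂)
  EFEquiv (L.sum (Language.constantsOn Unit)) M N α μ

end EFGame

namespace EFProof

open Cardinal

/-- Relation symbols. -/
abbrev Rel (Γ H Tag : Type) : Type :=
  (ℕ → Γ) ⊕ ((ℕ → ℕ) ⊕ ((Tag × (ℕ → H)) →₀ ZMod 2))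

/-- The language. -/
def Lang (Γ H Tag : Type) : FirstOrder.Language.{0, 0} :=
  ⟨fun _ => Empty, fun _ => Rel Γ H Tag⟩

/-- Reindexing. -/
def res {H Tag : Type} (ρ : ℕ → ℕ) (x : Tag × (ℕ → H)) : Tag × (ℕ → H) := (x.1, x.2 ∘ ρ)

section
variable {Γ H Tag : Type} (V : Tag → Γ → H → Γ → H → Prop)

/-- The universe of the model. -/
def Mod : Type :=
  {p : (ℕ → Γ) × ((Tag × (ℕ → H)) →₀ ZMod 2) //
    ∀ x ∈ p.2.support, ∀ n m, V x.1 (p.1 n) (x.2 n) (p.1 m) (x.2 m)}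

/-- Interpretation of the relations. -/
def relInt : Rel Γ H Tag → Mod V → Mod V → Prop
  | .inl s, p, _ => p.1.1 = s
  | .inr (.inl ρ), p, q => q.1.1 = p.1.1 ∘ ρ ∧ q.1.2 = Finsupp.mapDomain (res ρ) p.1.2
  | .inr (.inr g), p, q => q.1.1 = p.1.1 ∧ q.1.2 = p.1.2 + g

instance modStr : (Lang Γ H Tag).Structure (Mod V) where
  funMap := fun f => Empty.elim f
  RelMap := fun {n} r xs => ∀ i j : Fin n, i.1 = 0 → j.1 = 1 → relInt V r (xs i) (xs j)

theorem equiv_rel (f : (Lang Γ H Tag).Equiv (Mod V) (Mod V)) (r : Rel Γ H Tag) (p q : Mod V)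
    (h : relInt V r p q) : relInt V r (f p) (f q) := by
  have := (f.map_rel (n := 2) (r : (Lang Γ H Tag).Relations 2) ![p, q]).2 (by
    intro i j hi hj
    have hi' : i = 0 := Fin.ext hi
    have hj' : j = 1 := Fin.ext hj
    subst hi' hj'
    exact h)
  exact this 0 1 rfl rfl

/-- The zero element over `s`. -/
def zer (s : ℕ → Γ) : Mod V := ⟨(s, 0), by simp⟩

/-- Rigidity. -/
theorem rigid (hV : ∀ (a : Tag) (F : Γ → H), ∃ γ γ', ¬ V a γ (F γ) γ' (F γ'))
    (f : (Lang Γ H Tag).Equiv (Mod V) (Mod V)) (p : Mod V) : f p = p := by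
  classical
  have h1 : ∀ p, (f p).1.1 = p.1.1 := fun p => equiv_rel V f (.inl p.1.1) p p rfl
  let u : (ℕ → Γ) → ((Tag × (ℕ → H)) →₀ ZMod 2) := fun s => (f (zer V s)).1.2
  have hu : ∀ s, ∀ x ∈ (u s).support, ∀ n m, V x.1 (s n) (x.2 n) (s m) (x.2 m) := by
    intro s x hx n m
    have := (f (zer V s)).2 x hx n m
    rw [h1] at this
    exact this
  have h2 : ∀ p : Mod V, (f p).1.2 = u p.1.1 + p.1.2 := fun p =>
    (equiv_rel V f (.inr (.inr p.1.2)) (zer V p.1.1) p ⟨rfl, by simp [zer]⟩).2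
  have h3 : ∀ s ρ, u (s ∘ ρ) = Finsupp.mapDomain (res ρ) (u s) := fun s ρ =>
    (equiv_rel V f (.inr (.inl ρ)) (zer V s) (zer V (s ∘ ρ)) ⟨rfl, by simp [zer]⟩).2
  suffices h0 : ∀ s, u s = 0 by
    apply Subtype.ext
    apply Prod.ext
    · exact h1 p
    · rw [h2, h0, zero_add]
  by_contra! hne
  obtain ⟨s0, hs0⟩ := hne
  have hsub : ∀ s ρ, (u (s ∘ ρ)).support ⊆ (u s).support.image (res ρ) := by
    intro s ρ
    rw [h3]
    exact Finsupp.mapDomain_support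
  let N : (ℕ → Γ) → ℕ := fun s => (u s).support.card
  have hN : ∀ s ρ, N (s ∘ ρ) ≤ N s := fun s ρ =>
    (Finset.card_le_card (hsub s ρ)).trans Finset.card_image_le
  -- joint sequences
  have hjoin : ∀ S : ℕ → (ℕ → Γ), ∃ t : ℕ → Γ, ∀ k, ∃ ρ, S k = t ∘ ρ := by
    intro S
    refine ⟨fun n => S n.unpair.1 n.unpair.2, fun k => ⟨fun n => Nat.pair k n, ?_⟩⟩
    ext n
    simp
  have hbdd : BddAbove (Set.range N) := by
    by_contra hb
    rw [not_bddAbove_iff] at hb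
    have : ∀ k : ℕ, ∃ s, k < N s := by
      intro k
      obtain ⟨_, ⟨s, rfl⟩, h⟩ := hb k
      exact ⟨s, h⟩
    choose S hS using this
    obtain ⟨t, ht⟩ := hjoin S
    obtain ⟨ρ, hρ⟩ := ht (N t)
    have h4 := hS (N t)
    rw [hρ] at h4
    exact absurd (hN t ρ) (not_le.2 h4)
  have : Nonempty (ℕ → Γ) := ⟨s0⟩
  obtain ⟨s1, hs1⟩ : ∃ s1, ∀ s, N s ≤ N s1 := by
    obtain ⟨s1, hs1⟩ := Nat.sSup_mem (Set.range_nonempty N) hbdd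
    exact ⟨s1, fun s => hs1 ▸ le_csSup hbdd ⟨s, rfl⟩⟩
  obtain ⟨t, ht⟩ := hjoin (fun k => if k = 0 then s0 else s1)
  have htmax : ∀ s, N s ≤ N t := by
    intro s
    obtain ⟨ρ, hρ⟩ := ht 1
    simp only [one_ne_zero, if_false] at hρ
    exact (hs1 s).trans (hρ ▸ hN t ρ)
  have htne : u t ≠ 0 := by
    obtain ⟨ρ, hρ⟩ := ht 0
    simp only [if_true] at hρ
    intro h
    apply hs0
    rw [hρ, h3, h, Finsupp.mapDomain_zero]
  -- above `t`
  have key : ∀ s ρ, N (s ∘ ρ) = N t → (u (s ∘ ρ)).support = (u s).support.image (res ρ) ∧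
      Set.InjOn (res ρ) ((u s).support : Set (Tag × (ℕ → H))) := by
    intro s ρ h
    have e : (u (s ∘ ρ)).support = (u s).support.image (res ρ) := by
      apply Finset.eq_of_subset_of_card_le (hsub s ρ)
      exact Finset.card_image_le.trans ((htmax s).trans h.ge)
    refine ⟨e, ?_⟩
    apply Finset.card_image_iff.1
    rw [← e]
    exact le_antisymm (hN s ρ) ((htmax s).trans h.ge)
  obtain ⟨x0, hx0⟩ := Finsupp.support_nonempty_iff.2 htne
  let tc : Γ → ℕ → Γ := fun γ n => Nat.casesOn n γ t
  have htc : ∀ γ, tc γ ∘ Nat.succ = t := fun γ => rfl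
  have hNtc : ∀ γ, N (tc γ) = N t := fun γ =>
    le_antisymm (htmax _) (by conv_lhs => rw [← htc γ]
                              exact hN _ _)
  have hy : ∀ γ, ∃ y ∈ (u (tc γ)).support, res Nat.succ y = x0 := by
    intro γ
    have := (key (tc γ) Nat.succ (by rw [htc])).1
    rw [htc] at this
    rw [this] at hx0
    exact Finset.mem_image.1 hx0
  choose y hy1 hy2 using hy
  obtain ⟨γ, γ', hbad⟩ := hV x0.1 (fun γ => (y γ).2 0)
  apply hbad
  let t2 : ℕ → Γ := fun n => Nat.casesOn n γ (tc γ')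
  have e1 : t2 ∘ (fun n => Nat.casesOn n 0 (fun k => k + 2)) = tc γ := by
    ext n
    cases n <;> rfl
  have e2 : t2 ∘ Nat.succ = tc γ' := rfl
  have k1 := key t2 (fun n => Nat.casesOn n 0 (fun k => k + 2)) (by rw [e1, hNtc])
  have k2 := key t2 Nat.succ (by rw [e2, hNtc])
  rw [e1] at k1
  rw [e2] at k2
  have hz : ∃ z ∈ (u t2).support, res Nat.succ z = y γ' := by
    have := hy1 γ'
    rw [k2.1] at this
    exact Finset.mem_image.1 this
  obtain ⟨z, hz1, hz2⟩ := hz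
  have hz3 : res (fun n => Nat.casesOn n 0 (fun k => k + 2)) z = y γ := by
    have hm : res (fun n => Nat.casesOn n 0 (fun k => k + 2)) z ∈ (u (tc γ)).support := by
      rw [k1.1]
      exact Finset.mem_image_of_mem _ hz1
    have inj := (key (tc γ) Nat.succ (by rw [htc])).2
    apply inj hm (hy1 γ)
    rw [hy2, ← hy2 γ', ← hz2]
    rfl
  have a1 : z.1 = x0.1 := by rw [← hy2 γ', ← hz2]; rfl
  have := hu t2 z hz1 0 1
  rw [a1] at this
  have b1 : (y γ).2 0 = z.2 0 := by rw [← hz3]; rfl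
  have b2 : (y γ').2 0 = z.2 1 := by rw [← hz2]; rfl
  simp only [b1, b2]
  exact this

/-- The candidate partial isomorphism: translate by the assignment `F` above `D`. -/
def pis (a : Tag) (D : Set Γ) (F : Γ → H) : Set (Mod V × Mod V) :=
  {pq | pq.2.1.1 = pq.1.1.1 ∧ (∀ n, pq.1.1.1 n ∈ D) ∧
    pq.2.1.2 = pq.1.1.2 + Finsupp.single (a, F ∘ pq.1.1.1) 1}

theorem pis_rel (a : Tag) (D : Set Γ) (F : Γ → H) (r : Rel Γ H Tag) (p q : Mod V × Mod V)
    (hp : p ∈ pis V a D F) (hq : q ∈ pis V a D F) :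
    relInt V r p.1 q.1 ↔ relInt V r p.2 q.2 := by
  obtain ⟨p1, p2, p3⟩ := hp
  obtain ⟨q1, q2, q3⟩ := hq
  rcases r with s | ρ | g
  · simp only [relInt, p1]
  · simp only [relInt, p1, p3, q1, q3]
    refine and_congr_right fun h => ?_
    rw [Finsupp.mapDomain_add, Finsupp.mapDomain_single, h]
    simp [res, Function.comp_assoc]
  · simp only [relInt, p1, p3, q1, q3]
    refine and_congr_right fun h => ?_
    rw [h, add_right_comm]
    simp

theorem term_pair (f : Set (Mod V × Mod V)) (c₁ c₂ : Mod V) (hc : (c₁, c₂) ∈ f) (n : ℕ)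
    (xs : Fin n → Mod V × Mod V) (hxs : ∀ i, xs i ∈ f)
    (t : ((Lang Γ H Tag).sum (Language.constantsOn Unit)).Term (Empty ⊕ Fin n)) :
    (@Language.Term.realize _ (Mod V)
      (@Language.sumStructure _ _ (Mod V) _ (Language.constantsOn.structure (fun _ => c₁))) _
      (Sum.elim (fun e => e.elim) (fun i => (xs i).1)) t,
     @Language.Term.realize _ (Mod V)
      (@Language.sumStructure _ _ (Mod V) _ (Language.constantsOn.structure (fun _ => c₂))) _
      (Sum.elim (fun e => e.elim) (fun i => (xs i).2)) t) ∈ f := by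
  cases t with
  | var v =>
    rcases v with e | i
    · exact e.elim
    · exact hxs i
  | @func l g ts =>
    rcases g with g | g
    · exact Empty.elim g
    · cases l with
      | zero => exact hc
      | succ l => exact PEmpty.elim g

theorem partialIso (a : Tag) (D : Set Γ) (F : Γ → H) (c₁ c₂ : Mod V)
    (hc : (c₁, c₂) ∈ pis V a D F) :
    @EFGame.IsPartialIso ((Lang Γ H Tag).sum (Language.constantsOn Unit)) (Mod V) (Mod V)
      (@Language.sumStructure _ _ (Mod V) _ (Language.constantsOn.structure (fun _ => c₁)))
      (@Language.sumStructure _ _ (Mod V) _ (Language.constantsOn.structure (fun _ => c₂)))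
      (pis V a D F) := by
  have heq : ∀ p ∈ pis V a D F, ∀ q ∈ pis V a D F, p.1 = q.1 ↔ p.2 = q.2 := by
    rintro p ⟨p1, p2, p3⟩ q ⟨q1, q2, q3⟩
    constructor
    · intro h
      rw [h] at p1 p3
      exact Subtype.ext (Prod.ext (p1.trans q1.symm) (p3.trans q3.symm))
    · intro h
      have e : p.1.1.1 = q.1.1.1 := by rw [← p1, ← q1, h]
      refine Subtype.ext (Prod.ext e ?_)
      rw [h, q3, e] at p3
      exact (add_right_cancel p3).symm
  refine ⟨heq, ?_⟩
  intro n φ hφ xs hxs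
  cases hφ with
  | equal t₁ t₂ =>
    simp only [Language.BoundedFormula.realize_bdEqual]
    exact heq _ (term_pair V _ c₁ c₂ hc n xs hxs t₁) _ (term_pair V _ c₁ c₂ hc n xs hxs t₂)
  | @rel l R ts =>
    simp only [Language.BoundedFormula.realize_rel]
    rcases R with R | R
    · have : ∀ i j, _ ↔ _ := fun i j => pis_rel V a D F R _ _
        (term_pair V _ c₁ c₂ hc n xs hxs (ts i)) (term_pair V _ c₁ c₂ hc n xs hxs (ts j))
      exact forall_congr' fun i => forall_congr' fun j => imp_congr_right fun _ =>
        imp_congr_right fun _ => this i j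
    · exact Empty.elim R

theorem pis_cover (a : Tag) (D : Set Γ) (F : Γ → H)
    (hF : ∀ γ ∈ D, ∀ γ' ∈ D, V a γ (F γ) γ' (F γ')) (p : Mod V) (hp : ∀ n, p.1.1 n ∈ D) :
    p ∈ Prod.fst '' pis V a D F ∧ p ∈ Prod.snd '' pis V a D F := by
  classical
  let q : Mod V := ⟨(p.1.1, p.1.2 + Finsupp.single (a, F ∘ p.1.1) 1), by
    intro x hx n m
    rcases Finset.mem_union.1 (Finsupp.support_add hx) with h | h
    · exact p.2 x h n m
    · have := Finset.mem_singleton.1 (Finsupp.support_single_subset h)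
      subst this
      exact hF _ (hp n) _ (hp m)⟩
  refine ⟨⟨(p, q), ⟨rfl, hp, rfl⟩, rfl⟩, ⟨(q, p), ⟨rfl, hp, ?_⟩, rfl⟩⟩
  change p.1.2 = p.1.2 + Finsupp.single (a, F ∘ p.1.1) 1 + Finsupp.single (a, F ∘ p.1.1) 1
  rw [add_assoc, ← Finsupp.single_add]
  have : (1 + 1 : ZMod 2) = 0 := rfl
  simp [this]

/-- Coordinates occurring in a move. -/
def coords (A : Set (Mod V) × Set (Mod V)) : Set Γ :=
  {γ | ∃ p : Mod V, (p ∈ A.1 ∨ p ∈ A.2) ∧ ∃ n, p.1.1 n = γ}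

theorem coords_lt (lam : Cardinal.{0}) (h0 : ℵ₀ < lam) (A : Set (Mod V) × Set (Mod V))
    (hA : #A.1 + #A.2 < 1 + lam) : #(coords V A) < lam := by
  have h1 : 1 + lam = lam := Cardinal.add_eq_right h0.le (one_lt_aleph0.le.trans h0.le)
  rw [h1] at hA
  have : coords V A ⊆ Set.range (fun x : (A.1 ⊕ A.2) × ℕ =>
      (Sum.elim (fun p => p.1) (fun p => p.1) x.1 : Mod V).1.1 x.2) := by
    rintro γ ⟨p, hp | hp, n, rfl⟩
    · exact ⟨(.inl ⟨p, hp⟩, n), rfl⟩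
    · exact ⟨(.inr ⟨p, hp⟩, n), rfl⟩
  refine (mk_le_mk_of_subset this).trans_lt (mk_range_le.trans_lt ?_)
  simpa using mul_lt_of_lt h0.le hA h0

end

theorem sInf_agree (β : Ordinal.{0}) (S S' : Set Ordinal.{0}) (h : ∀ i ≤ β, i ∈ S ↔ i ∈ S')
    (i : Ordinal.{0}) (hi : i ≤ β) (hS : i ∈ S) : sInf S = sInf S' := by
  have a1 : sInf S ≤ β := (csInf_le' hS).trans hi
  have a2 : sInf S' ≤ β := (csInf_le' ((h i hi).1 hS)).trans hi
  apply le_antisymm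
  · exact csInf_le' ((h _ a2).2 (csInf_mem ⟨i, (h i hi).1 hS⟩))
  · exact csInf_le' ((h _ a1).1 (csInf_mem ⟨i, hS⟩))

section
variable (Λ : Type) [LinearOrder Λ]

/-- The local conditions on an assignment. -/
def W (a : Λ) (γ : Option Λ) (h : Λ × Λ) (γ' : Option Λ) (h' : Λ × Λ) : Prop :=
  (∀ x, γ = some x → h.1 < a ∧ x < h.2) ∧
  (∀ x x', γ = some x → γ' = some x' → h.1 = h'.1 → h.2 = h'.2)

theorem no_global (lam : Cardinal.{0}) (hreg : lam.IsRegular) (hΛ : #Λ = lam)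
    (hI : ∀ x : Λ, #(Set.Iio x) < lam) (a : Λ) (F : Option Λ → Λ × Λ) :
    ∃ γ γ', ¬ W Λ a γ (F γ) γ' (F γ') := by
  by_contra! h
  have hu : (⋃ i : Set.Iio a, {x : Λ | (F (some x)).1 = i.1}) = Set.univ := by
    ext x
    simp only [Set.mem_iUnion, Set.mem_univ, iff_true]
    exact ⟨⟨(F (some x)).1, ((h (some x) (some x)).1 x rfl).1⟩, rfl⟩
  have : #(⋃ i : Set.Iio a, {x : Λ | (F (some x)).1 = i.1}) < lam := by
    rw [card_iUnion_lt_iff_forall_of_isRegular hreg (hI a)]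
    intro i
    by_cases hx : ∃ x, (F (some x)).1 = i.1
    · obtain ⟨x, hx⟩ := hx
      refine (mk_le_mk_of_subset ?_).trans_lt (hI (F (some x)).2)
      intro y hy
      have h1 := ((h (some y) (some y)).1 y rfl).2
      have h2 := (h (some y) (some x)).2 y x rfl rfl (hy.trans hx.symm)
      rw [h2] at h1
      exact h1
    · have : {x : Λ | (F (some x)).1 = i.1} = ∅ := by
        ext x
        simp only [Set.mem_ofPred_eq, Set.mem_empty_iff_false, iff_false]
        exact fun h => hx ⟨x, h⟩
      rw [this]
      simpa using hreg.pos
  rw [hu, mk_univ, hΛ] at this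
  exact lt_irrefl _ this

/-- A strict upper bound for a set of coordinates. -/
noncomputable def ubd (d : Λ) (D : Set (Option Λ)) : Λ :=
  open Classical in if h : ∃ b, ∀ x, some x ∈ D → x < b then h.choose else d

theorem ubd_spec (d : Λ) (D : Set (Option Λ)) (h : ∃ b, ∀ x, some x ∈ D → x < b) (x : Λ)
    (hx : some x ∈ D) : x < ubd Λ d D := by
  rw [ubd, dif_pos h]
  exact h.choose_spec x hx

/-- Stage at which a coordinate first occurs. -/
noncomputable def stg (A : Ordinal.{0} → Set (Mod (W Λ)) × Set (Mod (W Λ))) (γ : Option Λ) :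
    Ordinal.{0} := sInf {i | γ ∈ coords (W Λ) (A i)}

theorem stg_le (A : Ordinal.{0} → Set (Mod (W Λ)) × Set (Mod (W Λ))) (γ : Option Λ)
    (i : Ordinal.{0}) (h : γ ∈ coords (W Λ) (A i)) : stg Λ A γ ≤ i :=
  csInf_le' (s := {i | γ ∈ coords (W Λ) (A i)}) h

/-- The assignment built along a play. -/
noncomputable def asg (J : Ordinal.{0} → Λ) (a : Λ)
    (A : Ordinal.{0} → Set (Mod (W Λ)) × Set (Mod (W Λ))) : Option Λ → Λ × Λ
  | none => (a, a)
  | some x => (J (stg Λ A (some x)), ubd Λ a (coords (W Λ) (A (stg Λ A (some x)))))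

/-- Coordinates played so far. -/
def dom (β : Ordinal.{0}) (A : Ordinal.{0} → Set (Mod (W Λ)) × Set (Mod (W Λ))) :
    Set (Option Λ) := {γ | γ = none ∨ ∃ i ≤ β, γ ∈ coords (W Λ) (A i)}

theorem game (lam : Cardinal.{0}) (h0 : ℵ₀ < lam)
    (hb : ∀ D : Set (Option Λ), #D < lam → ∃ b, ∀ x, some x ∈ D → x < b)
    (α : Ordinal.{0}) (J : Ordinal.{0} → Λ) (a : Λ) (hJa : ∀ i < α, J i < a)
    (hJ : ∀ i < α, ∀ j < α, J i = J j → i = j) :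
    ∃ c₁ c₂ : Mod (W Λ), c₁ ≠ c₂ ∧
      EFGame.EFEquivC (Lang (Option Λ) (Λ × Λ) Λ) (Mod (W Λ)) (Mod (W Λ)) c₁ c₂ α lam := by
  let c₁ : Mod (W Λ) := zer _ (fun _ => none)
  let c₂ : Mod (W Λ) := ⟨(fun _ => none, Finsupp.single (a, fun _ => (a, a)) 1), by
    intro x hx n m
    exact ⟨fun x h => by simp at h, fun x x' h => by simp at h⟩⟩
  refine ⟨c₁, c₂, ?_, ?_⟩
  · intro h
    have h2 : (0 : (Λ × (ℕ → Λ × Λ)) →₀ ZMod 2) = Finsupp.single (a, fun _ => (a, a)) 1 :=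
      congrArg (fun p : Mod (W Λ) => p.1.2) h
    exact one_ne_zero (Finsupp.single_eq_zero.1 h2.symm)
  refine ⟨fun β A => pis (W Λ) a (dom Λ β A) (asg Λ J a A), ?_, ?_⟩
  · intro β A A' hAA
    have hd : dom Λ β A = dom Λ β A' := by
      ext γ
      simp only [dom, Set.mem_ofPred_eq]
      refine or_congr_right (exists_congr fun i => and_congr_right fun hi => ?_)
      rw [hAA i hi]
    have hs : ∀ γ ∈ dom Λ β A, asg Λ J a A γ = asg Λ J a A' γ := by
      intro γ hγ
      cases γ with
      | none => rfl
      | some x =>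
        rcases hγ with h | ⟨i, hi, h⟩
        · simp at h
        · have e : stg Λ A (some x) = stg Λ A' (some x) :=
            sInf_agree β _ _ (fun j hj => by simp only [Set.mem_ofPred_eq, hAA j hj]) i hi h
          have le : stg Λ A (some x) ≤ β := (stg_le Λ A _ i h).trans hi
          simp only [asg]
          rw [← e, hAA _ le]
    ext pq
    simp only [pis, Set.mem_ofPred_eq, ← hd]
    refine and_congr_right fun _ => and_congr_right fun h => ?_
    have : asg Λ J a A ∘ pq.1.1.1 = asg Λ J a A' ∘ pq.1.1.1 := by
      funext n
      exact hs _ (h n)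
    rw [this]
  · intro A hA β hβ
    have hmono : ∀ γ < β, dom Λ γ A ⊆ dom Λ β A := by
      rintro γ hγ x (h | ⟨i, hi, h⟩)
      · exact .inl h
      · exact .inr ⟨i, hi.trans hγ.le, h⟩
    have hst : ∀ x, some x ∈ dom Λ β A → stg Λ A (some x) < α ∧
        some x ∈ coords (W Λ) (A (stg Λ A (some x))) := by
      rintro x (h | ⟨i, hi, h⟩)
      · simp at h
      · exact ⟨((stg_le Λ A _ i h).trans hi).trans_lt hβ,
          csInf_mem (s := {i | some x ∈ coords (W Λ) (A i)}) ⟨i, h⟩⟩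
    have hV : ∀ γ ∈ dom Λ β A, ∀ γ' ∈ dom Λ β A,
        W Λ a γ (asg Λ J a A γ) γ' (asg Λ J a A γ') := by
      intro γ hγ γ' hγ'
      constructor
      · rintro x rfl
        obtain ⟨h1, h2⟩ := hst x hγ
        exact ⟨hJa _ h1, ubd_spec Λ a _ (hb _ (coords_lt _ lam h0 _ (hA _ h1))) x h2⟩
      · rintro x x' rfl rfl h
        have := hJ _ (hst x hγ).1 _ (hst x' hγ').1 h
        simp only [asg]
        rw [this]
    refine ⟨?_, Set.empty_subset _, ?_, ?_, ?_⟩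
    · apply partialIso
      refine ⟨rfl, fun n => .inl rfl, ?_⟩
      change Finsupp.single (a, fun _ => (a, a)) 1 = 0 + Finsupp.single _ _
      rw [zero_add]
      rfl
    · rintro γ hγ pq ⟨h1, h2, h3⟩
      exact ⟨h1, fun n => hmono γ hγ (h2 n), h3⟩
    · intro p hp
      exact (pis_cover _ _ _ _ hV p fun n => .inr ⟨β, le_rfl, p, .inl hp, n, rfl⟩).1
    · intro p hp
      exact (pis_cover _ _ _ _ hV p fun n => .inr ⟨β, le_rfl, p, .inr hp, n, rfl⟩).2

end

theorem bounded (lam : Cardinal.{0}) (hreg : lam.IsRegular)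
    (D : Set (Option lam.ord.ToType)) (hD : #D < lam) :
    ∃ b : lam.ord.ToType, ∀ x, some x ∈ D → x < b := by
  let E : Set lam.ord.ToType := {x | some x ∈ D}
  have hE : #E < lam := by
    refine lt_of_le_of_lt ?_ hD
    exact mk_le_of_injective (f := fun x : E => (⟨some x.1, x.2⟩ : D)) (by
      intro x y h
      simpa [Subtype.ext_iff] using h)
  by_contra! h
  have hu : (⋃ b : E, Set.Iic b.1) = Set.univ := by
    ext x
    simp only [Set.mem_iUnion, Set.mem_univ, iff_true]
    obtain ⟨y, hy, hxy⟩ := h x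
    exact ⟨⟨y, hy⟩, hxy⟩
  have : #(⋃ b : E, Set.Iic b.1) < lam := by
    rw [card_iUnion_lt_iff_forall_of_isRegular hreg hE]
    intro b
    rw [← Set.Iio_union_right]
    refine (mk_union_le _ _).trans_lt (add_lt_of_lt hreg.aleph0_le (mk_Iio_toType_ord_lt _) ?_)
    simpa using hreg.nat_lt 1
  rw [hu, mk_univ] at this
  simp at this

end EFProof

/-- Conclusion 1.9(1): if `λ` is regular and `λ^ℵ₀ = λ`, then there is a first-order model
`M` of cardinality `λ`, in a vocabulary of cardinality at most `λ`, with no non-trivial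
automorphism, such that for every `α < λ` there are `c₁ ≠ c₂ ∈ M` with `(M, c₁)` and
`(M, c₂)` `EF_{α,λ}`-equivalent (hence `EF_α`-equivalent, and, by rigidity,
non-isomorphic). -/
theorem statement11 (lam : Cardinal.{0}) (hreg : lam.IsRegular)
    (hpow : lam ^ Cardinal.aleph0 = lam) :
    ∃ (L : FirstOrder.Language.{0, 0}) (M : Type) (inst : L.Structure M),
      L.card ≤ lam ∧ Cardinal.mk M = lam ∧
      (∀ f : @FirstOrder.Language.Equiv L M M inst inst, ∀ m : M, f.toEquiv m = m) ∧
      (∀ α : Ordinal.{0}, α < lam.ord →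
        ∃ c₁ c₂ : M, c₁ ≠ c₂ ∧ @EFGame.EFEquivC L M M inst inst c₁ c₂ α lam) := by
  classical
  have h0 : Cardinal.aleph0 < lam := by
    refine (Cardinal.cantor _).trans_le ?_
    rw [← hpow]
    exact Cardinal.power_le_power_right (hreg.nat_lt 2).le
  let Λ := lam.ord.ToType
  have hΛ : Cardinal.mk Λ = lam := by simp [Λ]
  have hinf : Infinite Λ := Cardinal.infinite_iff.2 (by rw [hΛ]; exact h0.le)
  have hO : Cardinal.mk (Option Λ) = lam := by
    rw [Cardinal.mk_option, hΛ]; exact Cardinal.add_one_eq h0.le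
  have hseq : Cardinal.mk (ℕ → Option Λ) = lam := by simp [hO, hpow]
  have hH : Cardinal.mk (Λ × Λ) = lam := by simp [hΛ, Cardinal.mul_eq_self h0.le]
  have hX : Cardinal.mk (Λ × (ℕ → Λ × Λ)) = lam := by
    rw [Cardinal.mk_prod]
    simp [hΛ, Cardinal.mul_eq_self h0.le, hpow]
  have hXi : Infinite (Λ × (ℕ → Λ × Λ)) := Cardinal.infinite_iff.2 (by rw [hX]; exact h0.le)
  have hG : Cardinal.mk ((Λ × (ℕ → Λ × Λ)) →₀ ZMod 2) = lam := by
    rw [Cardinal.mk_finsupp_of_infinite, hX]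
    exact max_eq_left ((Cardinal.mk_le_aleph0).trans h0.le)
  have hnn : Cardinal.mk (ℕ → ℕ) ≤ lam := by
    rw [← hpow]
    simpa using Cardinal.power_le_power_right (c := Cardinal.aleph0) h0.le
  refine ⟨EFProof.Lang (Option Λ) (Λ × Λ) Λ, EFProof.Mod (EFProof.W Λ), EFProof.modStr _,
    ?_, ?_, ?_, ?_⟩
  · have hR : Cardinal.mk (EFProof.Rel (Option Λ) (Λ × Λ) Λ) ≤ lam := by
      rw [Cardinal.mk_sum, Cardinal.mk_sum, hseq, hG]
      simp only [Cardinal.lift_id]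
      exact Cardinal.add_le_of_le h0.le le_rfl (Cardinal.add_le_of_le h0.le hnn le_rfl)
    rw [FirstOrder.Language.card, FirstOrder.Language.Symbols, Cardinal.mk_sum]
    have e1 : Cardinal.mk (Σ l, (EFProof.Lang (Option Λ) (Λ × Λ) Λ).Functions l) = 0 := by
      rw [Cardinal.mk_eq_zero_iff]
      exact ⟨fun x => Empty.elim x.2⟩
    have e2 : Cardinal.mk (Σ l, (EFProof.Lang (Option Λ) (Λ × Λ) Λ).Relations l) ≤ lam := by
      change Cardinal.mk (Σ _ : ℕ, EFProof.Rel (Option Λ) (Λ × Λ) Λ) ≤ lam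
      rw [Cardinal.mk_sigma, Cardinal.sum_const']
      exact Cardinal.mul_le_of_le h0.le (by simpa using h0.le) hR
    rw [e1]
    simpa using e2
  · apply le_antisymm
    · refine (Cardinal.mk_subtype_le _).trans ?_
      rw [Cardinal.mk_prod, hseq, hG]
      simp [Cardinal.mul_eq_self h0.le]
    · refine hΛ.symm.le.trans ?_
      refine Cardinal.mk_le_of_injective
        (f := fun x : Λ => EFProof.zer (EFProof.W Λ) (fun _ => some x)) ?_
      intro x y h
      have := congrFun (congrArg (fun p : EFProof.Mod (EFProof.W Λ) => p.1.1) h) 0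
      exact Option.some.inj this
  · intro f m
    exact EFProof.rigid (EFProof.W Λ)
      (EFProof.no_global Λ lam hreg hΛ (fun x => Cardinal.mk_Iio_toType_ord_lt x)) f m
  · intro α hα
    let J : Ordinal.{0} → Λ := fun i =>
      if h : i < lam.ord then Ordinal.ToType.mk ⟨i, h⟩ else Ordinal.ToType.mk ⟨α, hα⟩
    have hJ : ∀ i (h : i < lam.ord), J i = Ordinal.ToType.mk ⟨i, h⟩ := fun i h => dif_pos h
    refine EFProof.game Λ lam h0 (EFProof.bounded lam hreg) α J (J α) ?_ ?_
    · intro i hi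
      rw [hJ i (hi.trans hα), hJ α hα]
      exact Ordinal.ToType.mk.lt_iff_lt.2 hi
    · intro i hi j hj h
      rw [hJ i (hi.trans hα), hJ j (hj.trans hα)] at h
      exact congrArg Subtype.val (Ordinal.ToType.mk.injective h)
end

section
/- Let λ be a regular cardinal with λ^{ℵ₀} = λ. Then there is a first-order model M of cardinality λ with no non-trivial automorphism and a single pair of elements c₁ ≠ c₂ of M such that for every ordinal α < λ the expansions (M, c₁) and (M, c₂) are EF_{α,λ}-equivalent; since M is rigid, (M, c₁) and (M, c₂) are non-isomorphic. -/
open FirstOrder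

universe u

namespace EFRigid

open Cardinal

variable {Λ : Type} [LinearOrder Λ]

/-- Countable subsets of `Λ`. -/
abbrev Idx (Λ : Type) := {u : Set Λ // u.Countable}

/-- The binary coherence requirement on `F` at `i`, `j`. -/
def Legit (F : Λ → Λ × Λ × Λ) (i j : Λ) : Prop :=
  (F i).1 = (F j).1 ∧ (F i).2.1 < (F i).1 ∧ ((F i).2.1 = (F j).2.1 → j < (F i).2.2)

/-- Legitimate functions on the countable set `u`. -/
def T (u : Idx Λ) : Type :=
  {t : u.1 → Λ × Λ × Λ // ∀ i j : u.1, (t i).1 = (t j).1 ∧ (t i).2.1 < (t i).1 ∧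
    ((t i).2.1 = (t j).2.1 → j.1 < (t i).2.2)}

/-- Restriction. -/
def res {u v : Idx Λ} (h : v.1 ⊆ u.1) (t : T u) : T v :=
  ⟨fun i => t.1 ⟨i.1, h i.2⟩, fun i j => t.2 ⟨i.1, h i.2⟩ ⟨j.1, h j.2⟩⟩

/-- The free abelian group on `T u`. -/
abbrev G (u : Idx Λ) : Type := T u →₀ ℤ

/-- The universe of the model. -/
abbrev Mod (Λ : Type) [LinearOrder Λ] : Type := Σ u : Idx Λ, G u

/-- The partial isomorphism given by `F` on the sorts contained in `S`. -/
def iso (F : Λ → Λ × Λ × Λ) (S : Set Λ) : Set (Mod Λ × Mod Λ) :=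
  {p | ∃ (u : Idx Λ) (b : G u) (t : T u), u.1 ⊆ S ∧ (∀ i, t.1 i = F i.1) ∧
    p = (⟨u, b⟩, ⟨u, b + Finsupp.single t 1⟩)}

/-- The language: all relations invariant under the maps `iso F univ`. -/
def Lang (Λ : Type) [LinearOrder Λ] : FirstOrder.Language.{0, 0} where
  Functions _ := Empty
  Relations n := {R : Set (Fin n → Mod Λ) // ∀ (F : Λ → Λ × Λ × Λ) (xs : Fin n → Mod Λ × Mod Λ),
    (∀ i, xs i ∈ iso F Set.univ) → ((fun i => (xs i).1) ∈ R ↔ (fun i => (xs i).2) ∈ R)}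

instance instStr : (Lang Λ).Structure (Mod Λ) where
  funMap := fun f _ => Empty.elim f
  RelMap := fun R xs => xs ∈ R.1

theorem iso_mono {F : Λ → Λ × Λ × Λ} {S S' : Set Λ} (h : S ⊆ S') : iso F S ⊆ iso F S' := by
  rintro p ⟨u, b, t, hu, ht, rfl⟩
  exact ⟨u, b, t, hu.trans h, ht, rfl⟩

theorem T_ext {u : Idx Λ} {F : Λ → Λ × Λ × Λ} {t t' : T u} (h : ∀ i, t.1 i = F i.1)
    (h' : ∀ i, t'.1 i = F i.1) : t = t' :=
  Subtype.ext (funext fun i => (h i).trans (h' i).symm)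

theorem iso_inj {F : Λ → Λ × Λ × Λ} {S : Set Λ} {p q : Mod Λ × Mod Λ} (hp : p ∈ iso F S)
    (hq : q ∈ iso F S) : p.1 = q.1 ↔ p.2 = q.2 := by
  obtain ⟨u, b, t, hu, ht, rfl⟩ := hp
  obtain ⟨v, c, s, hv, hs, rfl⟩ := hq
  constructor
  · intro h
    obtain rfl : u = v := congrArg Sigma.fst h
    obtain rfl : b = c := by simpa using h
    obtain rfl := T_ext ht hs
    rfl
  · intro h
    obtain rfl : u = v := congrArg Sigma.fst h
    obtain rfl := T_ext ht hs
    have : b = c := by simpa using h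
    rw [this]

/-- The empty index. -/
def e0 : Idx Λ := ⟨∅, Set.countable_empty⟩

/-- The unique element of `T e0`. -/
def t0 : T (e0 : Idx Λ) := ⟨fun i => i.2.elim, fun i => i.2.elim⟩

/-- First constant. -/
noncomputable def c1 : Mod Λ := ⟨e0, 0⟩
/-- Second constant. -/
noncomputable def c2 : Mod Λ := ⟨e0, 0 + Finsupp.single t0 1⟩

theorem c_ne : (c1 : Mod Λ) ≠ c2 := by
  intro h
  have : (0 : G (e0 : Idx Λ)) = 0 + Finsupp.single t0 1 := by simpa [c1, c2] using h
  rw [zero_add] at this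
  exact one_ne_zero (Finsupp.single_eq_zero.1 this.symm)

theorem c_mem (F : Λ → Λ × Λ × Λ) (S : Set Λ) : ((c1 : Mod Λ), (c2 : Mod Λ)) ∈ iso F S :=
  ⟨e0, 0, t0, by simp [e0], fun i => i.2.elim, rfl⟩

theorem iso_partial (F : Λ → Λ × Λ × Λ) (S : Set Λ) :
    letI s1 : (Language.constantsOn Unit).Structure (Mod Λ) :=
      Language.constantsOn.structure (fun _ => c1)
    letI s2 : (Language.constantsOn Unit).Structure (Mod Λ) :=
      Language.constantsOn.structure (fun _ => c2)
    @EFGame.IsPartialIso ((Lang Λ).sum (Language.constantsOn Unit)) (Mod Λ) (Mod Λ)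
      (@Language.sumStructure _ _ _ _ s1) (@Language.sumStructure _ _ _ _ s2) (iso F S) := by
  let s1 : (Language.constantsOn Unit).Structure (Mod Λ) :=
    Language.constantsOn.structure (fun _ => c1)
  let s2 : (Language.constantsOn Unit).Structure (Mod Λ) :=
    Language.constantsOn.structure (fun _ => c2)
  refine ⟨fun p hp q hq => iso_inj hp hq, ?_⟩
  intro n φ hφ xs hxs
  have key : ∀ t : ((Lang Λ).sum (Language.constantsOn Unit)).Term (Empty ⊕ Fin n),
      (@Language.Term.realize _ _ (@Language.sumStructure _ _ _ _ s1) _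
          (Sum.elim (fun e : Empty => e.elim) fun i => (xs i).1) t,
        @Language.Term.realize _ _ (@Language.sumStructure _ _ _ _ s2) _
          (Sum.elim (fun e : Empty => e.elim) fun i => (xs i).2) t) ∈ iso F S := by
    intro t
    cases t with
    | var a =>
      rcases a with a | a
      · exact a.elim
      · exact hxs a
    | @func l f ts =>
      rcases f with f | f
      · exact Empty.elim f
      · rcases l with _ | l
        · exact c_mem F S
        · exact PEmpty.elim f
  cases hφ with
  | equal t1 t2 =>
    rw [@Language.BoundedFormula.realize_bdEqual, @Language.BoundedFormula.realize_bdEqual]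
    exact iso_inj (key t1) (key t2)
  | @rel l R ts =>
    rw [@Language.BoundedFormula.realize_rel, @Language.BoundedFormula.realize_rel]
    rcases R with R | R
    · exact R.2 F (fun i => (_, _)) (fun i => iso_mono (Set.subset_univ _) (key (ts i)))
    · exact Empty.elim R

/-- Binary relation symbol. -/
def mkRel (P : Mod Λ → Mod Λ → Prop)
    (hP : ∀ F, ∀ p ∈ iso F Set.univ, ∀ q ∈ iso F Set.univ, P p.1 q.1 ↔ P p.2 q.2) :
    (Lang Λ).Relations 2 :=
  ⟨{xs | P (xs 0) (xs 1)}, fun F xs h => hP F _ (h 0) _ (h 1)⟩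

theorem aut_rel (f : (Mod Λ) ≃[Lang Λ] (Mod Λ)) (P : Mod Λ → Mod Λ → Prop)
    (hP : ∀ F, ∀ p ∈ iso F Set.univ, ∀ q ∈ iso F Set.univ, P p.1 q.1 ↔ P p.2 q.2)
    (x y : Mod Λ) (h : P x y) : P (f x) (f y) := by
  have := (f.map_rel' (mkRel P hP) ![x, y]).2 h
  exact this

theorem aut_trans (f : (Mod Λ) ≃[Lang Λ] (Mod Λ)) (u : Idx Λ) (a b : G u) :
    ∃ c : G u, f ⟨u, b⟩ = ⟨u, c⟩ ∧ f ⟨u, b + a⟩ = ⟨u, c + a⟩ := by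
  refine aut_rel f (fun x y => ∃ c : G u, x = ⟨u, c⟩ ∧ y = ⟨u, c + a⟩) ?_ _ _ ⟨b, rfl, rfl⟩
  rintro F _ ⟨v, c, t, -, ht, rfl⟩ _ ⟨w, d, s, -, hs, rfl⟩
  constructor
  · rintro ⟨e, h1, h2⟩
    obtain rfl : v = u := congrArg Sigma.fst h1
    obtain rfl : w = v := congrArg Sigma.fst h2
    obtain rfl := T_ext ht hs
    obtain rfl : c = e := by simpa using h1
    obtain rfl : d = c + a := by simpa using h2
    exact ⟨_, rfl, by simp only [add_right_comm]⟩
  · rintro ⟨e, h1, h2⟩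
    obtain rfl : v = u := congrArg Sigma.fst h1
    obtain rfl : w = v := congrArg Sigma.fst h2
    obtain rfl := T_ext ht hs
    obtain rfl : c + Finsupp.single t 1 = e := by simpa using h1
    have h3 : d + Finsupp.single t 1 = c + Finsupp.single t 1 + a := by simpa using h2
    rw [add_right_comm] at h3
    exact ⟨_, rfl, by rw [add_right_cancel h3]⟩

theorem aut_res (f : (Mod Λ) ≃[Lang Λ] (Mod Λ)) (u v : Idx Λ) (h : v.1 ⊆ u.1) :
    ∃ c : G u, f ⟨u, 0⟩ = ⟨u, c⟩ ∧ f ⟨v, 0⟩ = ⟨v, Finsupp.mapDomain (res h) c⟩ := by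
  refine aut_rel f (fun x y => ∃ c : G u, x = ⟨u, c⟩ ∧ y = ⟨v, Finsupp.mapDomain (res h) c⟩)
    ?_ _ _ ⟨0, rfl, by simp⟩
  rintro F _ ⟨u', c, t, -, ht, rfl⟩ _ ⟨v', d, s, -, hs, rfl⟩
  constructor
  · rintro ⟨e, h1, h2⟩
    obtain rfl : u' = u := congrArg Sigma.fst h1
    obtain rfl : v' = v := congrArg Sigma.fst h2
    obtain rfl : c = e := by simpa using h1
    obtain rfl : d = _ := by simpa using h2
    obtain rfl : s = res h t := T_ext hs (fun i => ht _)
    exact ⟨_, rfl, by simp [Finsupp.mapDomain_add, Finsupp.mapDomain_single]⟩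
  · rintro ⟨e, h1, h2⟩
    obtain rfl : u' = u := congrArg Sigma.fst h1
    obtain rfl : v' = v := congrArg Sigma.fst h2
    obtain rfl : s = res h t := T_ext hs (fun i => ht _)
    obtain rfl : c + Finsupp.single t 1 = e := by simpa using h1
    have h3 : d + Finsupp.single (res h t) 1 = Finsupp.mapDomain (res h) (c + Finsupp.single t 1) := by
      simpa using h2
    rw [Finsupp.mapDomain_add, Finsupp.mapDomain_single] at h3
    exact ⟨_, rfl, by rw [add_right_cancel h3]⟩

theorem thread_fun (g : ∀ u : Idx Λ, G u)
    (hg : ∀ (u v : Idx Λ) (h : v.1 ⊆ u.1), Finsupp.mapDomain (res h) (g u) = g v)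
    (u₁ : Idx Λ) (hu₁ : g u₁ ≠ 0) : ∃ F : Λ → Λ × Λ × Λ, ∀ i j, Legit F i j := by
  classical
  have hsub : ∀ (u v : Idx Λ) (h : v.1 ⊆ u.1), (g v).support ⊆ (g u).support.image (res h) := by
    intro u v h
    rw [← hg u v h]
    exact Finsupp.mapDomain_support
  have hmono : ∀ (u v : Idx Λ) (h : v.1 ⊆ u.1), (g v).support.card ≤ (g u).support.card :=
    fun u v h => (Finset.card_le_card (hsub u v h)).trans Finset.card_image_le
  obtain ⟨B, hB⟩ : ∃ B, ∀ u, (g u).support.card ≤ B := by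
    by_contra! hcon
    choose w hw using hcon
    let U : Idx Λ := ⟨⋃ n, (w n).1, Set.countable_iUnion fun n => (w n).2⟩
    have h1 := hw (g U).support.card
    have h2 := hmono U (w (g U).support.card)
      (Set.subset_iUnion (fun n => (w n).1) (g U).support.card)
    omega
  obtain ⟨u₀, hu₀⟩ : ∃ u₀, ∀ u, (g u).support.card ≤ (g u₀).support.card := by
    have hbdd : BddAbove (Set.range fun u => (g u).support.card) := ⟨B, by rintro _ ⟨u, rfl⟩; exact hB u⟩
    obtain ⟨u₀, h0⟩ := Nat.sSup_mem (Set.range_nonempty_iff_nonempty.2 ⟨u₁⟩) hbdd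
    refine ⟨u₀, fun u => ?_⟩
    have : (g u).support.card ≤ _ := le_csSup hbdd ⟨u, rfl⟩
    simp only at h0
    omega
  have hpos : 0 < (g u₀).support.card :=
    lt_of_lt_of_le (Finset.card_pos.2 (Finsupp.support_nonempty_iff.2 hu₁)) (hu₀ u₁)
  obtain ⟨t₀, ht₀⟩ := Finset.card_pos.1 hpos
  have hcard : ∀ u : Idx Λ, u₀.1 ⊆ u.1 → (g u).support.card = (g u₀).support.card :=
    fun u h => le_antisymm (hu₀ u) (hmono _ _ h)
  have himg : ∀ (u v : Idx Λ) (h : v.1 ⊆ u.1), u₀.1 ⊆ v.1 →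
      (g u).support.image (res h) = (g v).support := by
    intro u v h h0
    symm
    apply Finset.eq_of_subset_of_card_le (hsub u v h)
    rw [hcard v h0, ← hcard u (h0.trans h)]
    exact Finset.card_image_le
  have hinj : ∀ (u : Idx Λ) (h : u₀.1 ⊆ u.1), Set.InjOn (res h) ((g u).support : Set (T u)) := by
    intro u h
    apply Finset.card_image_iff.1
    rw [himg u u₀ h subset_rfl, hcard u h]
  have hex : ∀ (u : Idx Λ) (h : u₀.1 ⊆ u.1), ∃ t ∈ (g u).support, res h t = t₀ := by
    intro u h
    have := hsub u u₀ h ht₀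
    simpa only [Finset.mem_image] using this
  choose L hL1 hL2 using hex
  have hcoh : ∀ (u v : Idx Λ) (h : v.1 ⊆ u.1) (h0 : u₀.1 ⊆ v.1),
      res h (L u (h0.trans h)) = L v h0 := by
    intro u v h h0
    apply hinj v h0
    · have : res h (L u (h0.trans h)) ∈ (g u).support.image (res h) :=
        Finset.mem_image_of_mem _ (hL1 _ _)
      rw [himg u v h h0] at this
      exact this
    · exact hL1 _ _
    · rw [hL2]
      exact hL2 u (h0.trans h)
  let ad : Λ → Idx Λ := fun i => ⟨insert i u₀.1, u₀.2.insert i⟩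
  let F : Λ → Λ × Λ × Λ := fun i =>
    (L (ad i) (Set.subset_insert _ _)).1 ⟨i, Set.mem_insert _ _⟩
  refine ⟨F, fun i j => ?_⟩
  let w : Idx Λ := ⟨insert i (insert j u₀.1), (u₀.2.insert j).insert i⟩
  have hw : u₀.1 ⊆ w.1 := (Set.subset_insert _ _).trans (Set.subset_insert _ _)
  have hiw : (ad i).1 ⊆ w.1 := Set.insert_subset_insert (Set.subset_insert _ _)
  have hjw : (ad j).1 ⊆ w.1 := Set.subset_insert _ _
  have e1 : F i = (L w hw).1 ⟨i, hiw (Set.mem_insert _ _)⟩ := by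
    have := hcoh w (ad i) hiw (Set.subset_insert _ _)
    simp only [F]
    rw [← this]
    rfl
  have e2 : F j = (L w hw).1 ⟨j, hjw (Set.mem_insert _ _)⟩ := by
    have := hcoh w (ad j) hjw (Set.subset_insert _ _)
    simp only [F]
    rw [← this]
    rfl
  unfold Legit
  rw [e1, e2]
  exact (L w hw).2 _ _

theorem no_fun {lam : Cardinal.{0}} (hreg : lam.IsRegular) (hΛ : #Λ = lam)
    (hI : ∀ i : Λ, #(Set.Iio i) < lam) (F : Λ → Λ × Λ × Λ) (hF : ∀ i j, Legit F i j) : False := by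
  have hne : Nonempty Λ := by
    rw [← Cardinal.mk_ne_zero_iff, hΛ]; exact hreg.ne_zero
  obtain ⟨z⟩ := hne
  have hlt : #(⋃ b ∈ Set.Iio (F z).1, {i | (F i).2.1 = b} : Set Λ) < lam := by
    rw [Cardinal.card_biUnion_lt_iff_forall_of_isRegular hreg (hI _)]
    intro b _
    by_cases hb : ∃ i, (F i).2.1 = b
    · obtain ⟨i, rfl⟩ := hb
      refine lt_of_le_of_lt (Cardinal.mk_le_mk_of_subset ?_) (hI (F i).2.2)
      intro j hj
      exact (hF i j).2.2 hj.symm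
    · have : {i | (F i).2.1 = b} = ∅ := by
        ext i; simp only [Set.mem_setOf_eq, Set.mem_empty_iff_false, iff_false]
        exact fun h => hb ⟨i, h⟩
      rw [this]; simpa using hreg.pos
  have huniv : (⋃ b ∈ Set.Iio (F z).1, {i | (F i).2.1 = b} : Set Λ) = Set.univ := by
    ext i
    simp only [Set.mem_iUnion, Set.mem_univ, iff_true]
    refine ⟨(F i).2.1, ?_, rfl⟩
    rw [Set.mem_Iio, ← (hF i z).1]
    exact (hF i z).2.1
  rw [huniv, Cardinal.mk_univ, hΛ] at hlt
  exact lt_irrefl _ hlt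

theorem rigid {lam : Cardinal.{0}} (hreg : lam.IsRegular) (hΛ : #Λ = lam)
    (hI : ∀ i : Λ, #(Set.Iio i) < lam) (f : (Mod Λ) ≃[Lang Λ] (Mod Λ)) (m : Mod Λ) : f m = m := by
  have h1 : ∀ u : Idx Λ, ∃ c : G u, f ⟨u, 0⟩ = ⟨u, c⟩ := fun u =>
    let ⟨c, h, _⟩ := aut_res f u u subset_rfl
    ⟨c, h⟩
  choose g hg using h1
  have hthr : ∀ (u v : Idx Λ) (h : v.1 ⊆ u.1), Finsupp.mapDomain (res h) (g u) = g v := by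
    intro u v h
    obtain ⟨c, h1, h2⟩ := aut_res f u v h
    rw [hg u] at h1
    rw [hg v] at h2
    obtain rfl : g u = c := by simpa using h1
    symm
    simpa using h2
  have hz : ∀ u, g u = 0 := by
    intro u
    by_contra hu
    obtain ⟨F, hF⟩ := thread_fun g hthr u hu
    exact no_fun hreg hΛ hI F hF
  obtain ⟨u, a⟩ := m
  obtain ⟨c, h1, h2⟩ := aut_trans f u a 0
  rw [hg u, hz u] at h1
  obtain rfl : 0 = c := by simpa using h1
  simpa using h2

theorem mk_Mod {lam : Cardinal.{0}} (hreg : lam.IsRegular) (hpow : lam ^ ℵ₀ = lam)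
    (hΛ : #Λ = lam) : #(Mod Λ) = lam := by
  have hinf : Infinite Λ := by
    rw [Cardinal.infinite_iff, hΛ]; exact hreg.aleph0_le
  apply le_antisymm
  · have hIdx : #(Idx Λ) ≤ lam := by
      have := Cardinal.mk_bounded_set_le_of_infinite Λ ℵ₀
      rw [hΛ, hpow] at this
      simpa only [Cardinal.le_aleph0_iff_set_countable] using this
    have hX : #(Λ × Λ × Λ) = lam := by
      simp [hΛ, Cardinal.mul_eq_self hreg.aleph0_le]
    have hT : ∀ u : Idx Λ, #(T u) ≤ lam := by
      intro u
      refine (Cardinal.mk_subtype_le _).trans ?_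
      rw [← Cardinal.power_def, hX]
      refine le_trans (Cardinal.power_le_power_left hreg.ne_zero ?_) hpow.le
      exact Cardinal.le_aleph0_iff_set_countable.2 u.2
    have hG : ∀ u : Idx Λ, #(G u) ≤ lam := by
      intro u
      rcases isEmpty_or_nonempty (T u) with h | h
      · exact (Cardinal.mk_le_one_iff_set_subsingleton.2 (Set.subsingleton_of_subsingleton (s := Set.univ)) |>.trans' (by rw [Cardinal.mk_univ])).trans (hreg.nat_lt 1 |>.le |>.trans' (by simp))
      · rw [Cardinal.mk_finsupp_of_infinite']
        exact max_le (hT u) (by simpa using hreg.aleph0_le)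
    rw [Cardinal.mk_sigma]
    refine (Cardinal.sum_le_sum _ (fun _ => lam) hG).trans ?_
    simp only [Cardinal.sum_const, Cardinal.lift_id]
    exact (mul_le_mul_left hIdx _).trans (Cardinal.mul_eq_self hreg.aleph0_le).le
  · rw [← hΛ]
    refine Cardinal.mk_le_of_injective (f := fun i : Λ => (⟨⟨{i}, Set.countable_singleton i⟩, 0⟩ : Mod Λ)) ?_
    intro i j h
    have := congrArg (fun x : Mod Λ => x.1.1) h
    simpa using this

/-- All ordinals mentioned by a move. -/
def U (P : Set (Mod Λ) × Set (Mod Λ)) : Set Λ := ⋃ x ∈ P.1 ∪ P.2, x.1.1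

/-- All ordinals mentioned up to stage `β`. -/
def S (A : Ordinal.{0} → Set (Mod Λ) × Set (Mod Λ)) (β : Ordinal.{0}) : Set Λ :=
  {i | ∃ γ ≤ β, i ∈ U (A γ)}

/-- The first stage where `i` is mentioned. -/
noncomputable def lev (A : Ordinal.{0} → Set (Mod Λ) × Set (Mod Λ)) (i : Λ) : Ordinal.{0} :=
  sInf {γ | i ∈ U (A γ)}

theorem lev_mem {A : Ordinal.{0} → Set (Mod Λ) × Set (Mod Λ)} {β : Ordinal.{0}} {i : Λ}
    (h : i ∈ S A β) : i ∈ U (A (lev A i)) := by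
  obtain ⟨γ, _, hγ⟩ := h
  exact csInf_mem (s := {γ | i ∈ U (A γ)}) ⟨γ, hγ⟩

theorem lev_le' {A : Ordinal.{0} → Set (Mod Λ) × Set (Mod Λ)} {γ : Ordinal.{0}} {i : Λ}
    (h : i ∈ U (A γ)) : lev A i ≤ γ := csInf_le' (s := {γ | i ∈ U (A γ)}) h

theorem lev_le {A : Ordinal.{0} → Set (Mod Λ) × Set (Mod Λ)} {β : Ordinal.{0}} {i : Λ}
    (h : i ∈ S A β) : lev A i ≤ β := by
  obtain ⟨γ, hγ', hγ⟩ := h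
  exact (lev_le' hγ).trans hγ'

theorem S_congr {A A' : Ordinal.{0} → Set (Mod Λ) × Set (Mod Λ)} {β : Ordinal.{0}}
    (h : ∀ γ ≤ β, A γ = A' γ) : S A β = S A' β := by
  ext i
  constructor
  · rintro ⟨γ, h1, h2⟩; exact ⟨γ, h1, h γ h1 ▸ h2⟩
  · rintro ⟨γ, h1, h2⟩; exact ⟨γ, h1, (h γ h1).symm ▸ h2⟩

theorem lev_congr {A A' : Ordinal.{0} → Set (Mod Λ) × Set (Mod Λ)} {β : Ordinal.{0}}
    (h : ∀ γ ≤ β, A γ = A' γ) {i : Λ} (hi : i ∈ S A β) : lev A i = lev A' i := by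
  have hi' : i ∈ S A' β := S_congr h ▸ hi
  apply le_antisymm
  · apply lev_le'
    rw [h _ (lev_le hi')]
    exact lev_mem hi'
  · apply lev_le'
    rw [← h _ (lev_le hi)]
    exact lev_mem hi

open Classical in
/-- A strict upper bound, if any. -/
noncomputable def bnd [Nonempty Λ] (s : Set Λ) : Λ :=
  if h : ∃ c, ∀ i ∈ s, i < c then h.choose else Classical.arbitrary Λ

theorem bnd_spec [Nonempty Λ] {s : Set Λ} (h : ∃ c, ∀ i ∈ s, i < c) : ∀ i ∈ s, i < bnd s := by
  unfold bnd
  rw [dif_pos h]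
  exact h.choose_spec

/-- The function played by ISO. -/
noncomputable def play [Nonempty Λ] (e : Ordinal.{0} → Λ) (α : Ordinal.{0})
    (A : Ordinal.{0} → Set (Mod Λ) × Set (Mod Λ)) (i : Λ) : Λ × Λ × Λ :=
  (e α, e (lev A i), bnd (S A (lev A i)))

theorem play_congr [Nonempty Λ] (e : Ordinal.{0} → Λ) (α : Ordinal.{0})
    {A A' : Ordinal.{0} → Set (Mod Λ) × Set (Mod Λ)} {β : Ordinal.{0}}
    (h : ∀ γ ≤ β, A γ = A' γ) {i : Λ} (hi : i ∈ S A β) : play e α A i = play e α A' i := by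
  unfold play
  rw [← lev_congr h hi, S_congr (fun γ hγ => h γ (hγ.trans (lev_le hi)))]

theorem iso_congr {F F' : Λ → Λ × Λ × Λ} {s : Set Λ} (h : ∀ i ∈ s, F i = F' i) :
    iso F s ⊆ iso F' s := by
  rintro p ⟨u, b, t, hu, ht, rfl⟩
  exact ⟨u, b, t, hu, fun i => (ht i).trans (h _ (hu i.2)), rfl⟩

theorem exists_bound {lam : Cardinal.{0}} (hreg : lam.IsRegular) (hΛ : #Λ = lam)
    (hI : ∀ i : Λ, #(Set.Iio i) < lam) (s : Set Λ) (hs : #s < lam) : ∃ c, ∀ i ∈ s, i < c := by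
  by_contra! hcon
  have hlt : #(⋃ b ∈ s, Set.Iic b : Set Λ) < lam := by
    rw [Cardinal.card_biUnion_lt_iff_forall_of_isRegular hreg hs]
    intro b _
    rw [← Set.Iio_insert]
    refine lt_of_le_of_lt Cardinal.mk_insert_le ?_
    exact Cardinal.add_lt_of_lt hreg.aleph0_le (hI b) (by simpa using hreg.nat_lt 1)
  have huniv : (⋃ b ∈ s, Set.Iic b : Set Λ) = Set.univ := by
    ext i
    simpa using hcon i
  rw [huniv, Cardinal.mk_univ, hΛ] at hlt
  exact lt_irrefl _ hlt

theorem mk_S {lam : Cardinal.{0}} (hreg : lam.IsRegular) (hunc : ℵ₀ < lam) {α : Ordinal.{0}}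
    (hα : α < lam.ord) (A : Ordinal.{0} → Set (Mod Λ) × Set (Mod Λ))
    (hA : ∀ β, β < α → #(A β).1 + #(A β).2 < 1 + lam) {β : Ordinal.{0}} (hβ : β < α) :
    #(S A β) < lam := by
  have hU : ∀ γ < α, #(U (A γ)) < lam := by
    intro γ hγ
    unfold U
    rw [Cardinal.card_biUnion_lt_iff_forall_of_isRegular hreg]
    · intro x _
      exact (Cardinal.le_aleph0_iff_set_countable.2 x.1.2).trans_lt hunc
    · refine (Cardinal.mk_union_le _ _).trans_lt ?_
      have := hA γ hγ
      rwa [Cardinal.add_eq_right hreg.aleph0_le (hreg.nat_lt 1 |>.le |>.trans' (by simp))] at this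
  have hsub : S A β ⊆ ⋃ k : α.ToType, U (A (Ordinal.ToType.toOrd k).1) := by
    rintro i ⟨γ, hγ, hi⟩
    rw [Set.mem_iUnion]
    refine ⟨Ordinal.ToType.mk ⟨γ, hγ.trans_lt hβ⟩, ?_⟩
    simpa using hi
  refine (Cardinal.mk_le_mk_of_subset hsub).trans_lt ?_
  rw [Cardinal.card_iUnion_lt_iff_forall_of_isRegular hreg]
  · exact fun k => hU _ (Ordinal.ToType.toOrd k).2
  · rw [Cardinal.mk_toType]
    exact Cardinal.lt_ord.1 hα

theorem win {lam : Cardinal.{0}} (hreg : lam.IsRegular) (hunc : ℵ₀ < lam) (hΛ : #Λ = lam)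
    (hI : ∀ i : Λ, #(Set.Iio i) < lam) (e : Ordinal.{0} → Λ)
    (he : ∀ a b, a < b → b < lam.ord → e a < e b) (α : Ordinal.{0}) (hα : α < lam.ord) :
    EFGame.EFEquivC (Lang Λ) (Mod Λ) (Mod Λ) c1 c2 α lam := by
  haveI : Nonempty Λ := ⟨e 0⟩
  refine ⟨fun β A => iso (play e α A) (S A β), ?_, ?_⟩
  · intro β A A' h
    apply Set.Subset.antisymm
    · refine (iso_congr fun i hi => play_congr e α h hi).trans ?_
      rw [S_congr h]
    · refine (iso_congr fun i hi => play_congr e α (fun γ hγ => (h γ hγ).symm) hi).trans ?_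
      rw [← S_congr h]
  · intro A hA β hβ
    have hleg : ∀ u : Idx Λ, u.1 ⊆ S A β → ∃ t : T u, ∀ i, t.1 i = play e α A i.1 := by
      intro u hu
      refine ⟨⟨fun i => play e α A i.1, fun i j => ⟨rfl, ?_, ?_⟩⟩, fun i => rfl⟩
      · exact he _ _ ((lev_le (hu i.2)).trans_lt hβ) hα
      · intro hij
        have hi := (lev_le (hu i.2)).trans_lt hβ
        have hj := (lev_le (hu j.2)).trans_lt hβ
        have hlev : lev A i.1 = lev A j.1 := by
          rcases lt_trichotomy (lev A i.1) (lev A j.1) with h | h | h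
          · exact absurd hij (he _ _ h (hj.trans hα)).ne
          · exact h
          · exact absurd hij (he _ _ h (hi.trans hα)).ne'
        refine bnd_spec (exists_bound hreg hΛ hI _ (mk_S hreg hunc hα A hA hi)) _ ?_
        rw [hlev]
        exact ⟨_, le_rfl, lev_mem (hu j.2)⟩
    refine ⟨iso_partial _ _, Set.empty_subset _, ?_, ?_, ?_⟩
    · intro γ hγ
      exact iso_mono fun i ⟨δ, h1, h2⟩ => ⟨δ, h1.trans hγ.le, h2⟩
    · rintro ⟨u, b⟩ hx
      have hu : u.1 ⊆ S A β := fun i hi => ⟨β, le_rfl, Set.mem_biUnion (Or.inl hx) hi⟩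
      obtain ⟨t, ht⟩ := hleg u hu
      exact ⟨_, ⟨u, b, t, hu, ht, rfl⟩, rfl⟩
    · rintro ⟨u, b⟩ hx
      have hu : u.1 ⊆ S A β := fun i hi => ⟨β, le_rfl, Set.mem_biUnion (Or.inr hx) hi⟩
      obtain ⟨t, ht⟩ := hleg u hu
      exact ⟨_, ⟨u, b - Finsupp.single t 1, t, hu, ht, rfl⟩, by simp⟩

end EFRigid

/-- Conclusion 1.9(2): if `λ` is regular and `λ^ℵ₀ = λ`, then there is a first-order model
`M` of cardinality `λ` with no non-trivial automorphism and a single pair `c₁ ≠ c₂ ∈ M`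
such that for every `α < λ` the expansions `(M, c₁)` and `(M, c₂)` are
`EF_{α,λ}`-equivalent (and, by rigidity, non-isomorphic). -/
theorem statement12 (lam : Cardinal.{0}) (hreg : lam.IsRegular)
    (hpow : lam ^ Cardinal.aleph0 = lam) :
    ∃ (L : FirstOrder.Language.{0, 0}) (M : Type) (inst : L.Structure M),
      Cardinal.mk M = lam ∧
      (∀ f : @FirstOrder.Language.Equiv L M M inst inst, ∀ m : M, f.toEquiv m = m) ∧
      (∃ c₁ c₂ : M, c₁ ≠ c₂ ∧
        ∀ α : Ordinal.{0}, α < lam.ord →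
          @EFGame.EFEquivC L M M inst inst c₁ c₂ α lam) := by
  classical
  have hunc : Cardinal.aleph0 < lam := by
    have h2 : (2 : Cardinal.{0}) ≤ lam := by exact_mod_cast (hreg.nat_lt 2).le
    calc Cardinal.aleph0 < 2 ^ Cardinal.aleph0 := Cardinal.cantor _
      _ ≤ lam ^ Cardinal.aleph0 := Cardinal.power_le_power_right h2
      _ = lam := hpow
  have hΛ : Cardinal.mk lam.ord.ToType = lam := Cardinal.mk_ord_toType lam
  have hI : ∀ i : lam.ord.ToType, Cardinal.mk (Set.Iio i) < lam :=
    fun i => Cardinal.mk_Iio_toType_ord_lt i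
  refine ⟨EFRigid.Lang lam.ord.ToType, EFRigid.Mod lam.ord.ToType, EFRigid.instStr,
    EFRigid.mk_Mod hreg hpow hΛ, fun f m => EFRigid.rigid hreg hΛ hI f m,
    EFRigid.c1, EFRigid.c2, EFRigid.c_ne, fun α hα => ?_⟩
  refine EFRigid.win hreg hunc hΛ hI
    (fun o => if h : o < lam.ord then Ordinal.ToType.mk ⟨o, h⟩
      else Ordinal.ToType.mk ⟨0, hreg.ord_pos⟩) ?_ α hα
  intro a b hab hb
  simp only [hab.trans hb, hb, dif_pos]
  rw [OrderIso.lt_iff_lt]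
  exact hab
end
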